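/- Let Λ > 0 and U > 0. Then for every (u₁,r₁) ∈ [0,U]×[0, r_c) with r_c := √(3/Λ), with s ↦ r(s) the characteristic through (u₁,r₁), one has 1 − e^{−(Λ/3)∫₀^{u₁} r(s) ds} ≤ 1 − (1/4) e^{−√(Λ/3) U} < 1. -/

import Mathlib

open Real Set

/-- `χ` is the characteristic through `(u₁,r₁)`: it solves
`χ' = -(1/2)(1 - (Λ/3) χ²)` on `[0,u₁]` with `χ(u₁) = r₁`. -/
def IsChar (Λ u₁ r₁ : ℝ) (χ : ℝ → ℝ) : Prop :=
  χ u₁ = r₁ ∧ ∀ s ∈ Set.Icc 0 u₁, HasDerivAt χ (-(1/2) * (1 - Λ/3 * (χ s)^2)) s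

theorem IsChar.continuousOn {Λ u₁ r₁ : ℝ} {χ : ℝ → ℝ} (hχ : IsChar Λ u₁ r₁ χ) :
    ContinuousOn χ (Set.Icc 0 u₁) :=
  fun s hs => (hχ.2 s hs).continuousAt.continuousWithinAt

/-- A characteristic ending below a level `c ≥ √(3/Λ)` stays below it: characteristics increase
while above `√(3/Λ)`. -/
theorem IsChar.le_of_lt {Λ u₁ r₁ c : ℝ} {χ : ℝ → ℝ} (hχ : IsChar Λ u₁ r₁ χ) (hΛ : 0 < Λ)
    (hc : 0 ≤ c) (hcΛ : 1 ≤ Λ / 3 * c ^ 2) (hr : r₁ < c) {s : ℝ} (hs : s ∈ Set.Icc 0 u₁) :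
    χ s ≤ c := by
  by_contra! hlt
  have hsub : Set.Icc s u₁ ⊆ Set.Icc 0 u₁ := Set.Icc_subset_Icc_left hs.1
  have hle : χ s ≤ χ u₁ :=
    image_le_of_deriv_right_lt_deriv_boundary' (f := fun _ => χ s) (f' := fun _ => 0)
      continuousOn_const (fun x _ => hasDerivWithinAt_const x _ _) le_rfl
      (hχ.continuousOn.mono hsub)
      (fun x hx => (hχ.2 x (hsub (Set.Ico_subset_Icc_self hx))).hasDerivWithinAt)
      (fun x _ hx => by
        have hsq : c ^ 2 < χ s ^ 2 := pow_lt_pow_left₀ hlt hc two_ne_zero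
        have hmul : Λ / 3 * c ^ 2 < Λ / 3 * χ s ^ 2 :=
          mul_lt_mul_of_pos_left hsq (by positivity)
        rw [← hx]
        linarith)
      (Set.right_mem_Icc.2 hs.2)
  linarith [hχ.1]

/-- Contraction factor estimate in the local region: for `U > 0`
and `(u₁,r₁) ∈ [0,U] × [0,r_c)` with `r_c = √(3/Λ)`, with `χ` the characteristic
through `(u₁,r₁)`, `1 - e^{-(Λ/3)∫₀^{u₁} χ} ≤ 1 - (1/4) e^{-√(Λ/3) U} < 1`. -/
theorem contraction_factor_local
    (Λ U : ℝ) (hΛ : 0 < Λ) (hU : 0 < U)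
    (u₁ r₁ : ℝ) (hu₁ : u₁ ∈ Set.Icc 0 U)
    (hr₁ : r₁ ∈ Set.Ico 0 (Real.sqrt (3 / Λ)))
    (χ : ℝ → ℝ) (hχ : IsChar Λ u₁ r₁ χ) :
    1 - Real.exp (-(Λ/3) * ∫ s in (0:ℝ)..u₁, χ s)
        ≤ 1 - (1/4) * Real.exp (-Real.sqrt (Λ / 3) * U) ∧
      1 - (1/4) * Real.exp (-Real.sqrt (Λ / 3) * U) < 1 := by
  obtain ⟨hu₀, huU⟩ := hu₁
  refine ⟨?_, sub_lt_self _ (by positivity)⟩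
  have hsq : Λ / 3 * Real.sqrt (3 / Λ) ^ 2 = 1 := by
    rw [Real.sq_sqrt (by positivity)]
    field_simp
  have hroot : Λ / 3 * Real.sqrt (3 / Λ) = Real.sqrt (Λ / 3) := by
    rw [← inv_div Λ 3, Real.sqrt_inv, ← div_eq_mul_inv, Real.div_sqrt]
  have hint : ∫ s in (0:ℝ)..u₁, χ s ≤ Real.sqrt (3 / Λ) * u₁ := by
    have hmono := intervalIntegral.integral_mono_on (μ := MeasureTheory.volume) hu₀
      (hχ.continuousOn.intervalIntegrable_of_Icc hu₀) intervalIntegrable_const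
      (fun s hs => hχ.le_of_lt hΛ (Real.sqrt_nonneg _) hsq.ge hr₁.2 hs)
    rwa [intervalIntegral.integral_const, sub_zero, smul_eq_mul, mul_comm] at hmono
  have hexponent : Λ / 3 * ∫ s in (0:ℝ)..u₁, χ s ≤ Real.sqrt (Λ / 3) * U :=
    calc Λ / 3 * ∫ s in (0:ℝ)..u₁, χ s
        ≤ Λ / 3 * (Real.sqrt (3 / Λ) * u₁) := mul_le_mul_of_nonneg_left hint (by positivity)
      _ = Real.sqrt (Λ / 3) * u₁ := by rw [← mul_assoc, hroot]
      _ ≤ Real.sqrt (Λ / 3) * U := mul_le_mul_of_nonneg_left huU (Real.sqrt_nonneg _)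
  have hexp : Real.exp (-Real.sqrt (Λ / 3) * U)
      ≤ Real.exp (-(Λ/3) * ∫ s in (0:ℝ)..u₁, χ s) :=
    Real.exp_le_exp.2 (by linarith)
  linarith [Real.exp_pos (-Real.sqrt (Λ / 3) * U)]
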